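/- arXiv:1207.0666 — 2 statements merged into one kernel-verified Lean document; each statement's English description precedes it below -/
import Mathlib

section
/- Let H be a right ℍ-module, let J : H → H be right ℍ-linear with J(Ju) = −u for all u ∈ H, let ι ∈ 𝕊, and set H₊^{Jι} = {u : Ju = uι}, H₋^{Jι} = {u : Ju = −uι}. Then every x ∈ H decomposes uniquely as x = x₊ + x₋ with x₊ ∈ H₊^{Jι} and x₋ ∈ H₋^{Jι}, namely x₊ = (x − J(x)ι)(1/2) and x₋ = (x + J(x)ι)(1/2); in particular H₊^{Jι} ∩ H₋^{Jι} = {0}. Moreover, for any j ∈ 𝕊 with ιj = −jι, the map y ↦ yj is a bijection from H₊^{Jι} onto H₋^{Jι}. -/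
/-- A right `ℍ`-module: an additive abelian group `H` with a right scalar multiplication
`smul : H → ℍ → H` satisfying the module axioms. -/
structure RightQModule (H : Type*) [AddCommGroup H] where
  smul : H → Quaternion ℝ → H
  add_smul : ∀ (u v : H) (q : Quaternion ℝ), smul (u + v) q = smul u q + smul v q
  smul_add : ∀ (u : H) (p q : Quaternion ℝ), smul u (p + q) = smul u p + smul u q
  smul_mul : ∀ (u : H) (p q : Quaternion ℝ), smul u (p * q) = smul (smul u p) q
  smul_one : ∀ u : H, smul u 1 = u

/-- A map `T : H → H` is right `ℍ`-linear when `T (u·a + v·b) = (T u)·a + (T v)·b`. -/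
def RightQModule.IsRightLinear {H : Type*} [AddCommGroup H]
    (M : RightQModule H) (T : H → H) : Prop :=
  ∀ (u v : H) (a b : Quaternion ℝ),
    T (M.smul u a + M.smul v b) = M.smul (T u) a + M.smul (T v) b

namespace RightQModule

variable {H : Type*} [AddCommGroup H] (M : RightQModule H)

theorem zero_smul (q : Quaternion ℝ) : M.smul 0 q = 0 := by
  simpa using M.add_smul 0 0 q

theorem smul_zero (u : H) : M.smul u 0 = 0 := by
  simpa using M.smul_add u 0 0

theorem neg_smul (u : H) (q : Quaternion ℝ) : M.smul (-u) q = -M.smul u q := by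
  rw [eq_neg_iff_add_eq_zero, ← M.add_smul, neg_add_cancel, M.zero_smul]

theorem smul_neg (u : H) (q : Quaternion ℝ) : M.smul u (-q) = -M.smul u q := by
  rw [eq_neg_iff_add_eq_zero, ← M.smul_add, neg_add_cancel, M.smul_zero]

theorem sub_smul (u v : H) (q : Quaternion ℝ) :
    M.smul (u - v) q = M.smul u q - M.smul v q := by
  rw [sub_eq_add_neg, M.add_smul, M.neg_smul, sub_eq_add_neg]

theorem smul_smul_self_of_sq_eq_neg_one {q : Quaternion ℝ} (hq : q ^ 2 = -1) (u : H) :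
    M.smul (M.smul u q) q = -u := by
  rw [← M.smul_mul, ← pow_two, hq, M.smul_neg, M.smul_one]

theorem smul_smul_coe_comm (u : H) (r : ℝ) (q : Quaternion ℝ) :
    M.smul (M.smul u (r : Quaternion ℝ)) q = M.smul (M.smul u q) (r : Quaternion ℝ) := by
  rw [← M.smul_mul, ← M.smul_mul, Quaternion.coe_commutes]

theorem add_self_smul_half (u : H) :
    M.smul (u + u) (((1 : ℝ) / 2 : ℝ) : Quaternion ℝ) = u := by
  rw [M.add_smul, ← M.smul_add, ← Quaternion.coe_add, add_halves, Quaternion.coe_one,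
    M.smul_one]

variable {M} {T : H → H}

theorem IsRightLinear.map_add (hT : M.IsRightLinear T) (u v : H) :
    T (u + v) = T u + T v := by
  simpa only [M.smul_one] using hT u v 1 1

theorem IsRightLinear.map_smul (hT : M.IsRightLinear T) (u : H) (q : Quaternion ℝ) :
    T (M.smul u q) = M.smul (T u) q := by
  simpa only [M.smul_zero, add_zero] using hT u 0 q 0

theorem IsRightLinear.map_neg (hT : M.IsRightLinear T) (u : H) : T (-u) = -T u := by
  simpa only [M.smul_neg, M.smul_one] using hT.map_smul u (-1)

theorem IsRightLinear.map_sub (hT : M.IsRightLinear T) (u v : H) :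
    T (u - v) = T u - T v := by
  rw [sub_eq_add_neg, hT.map_add, hT.map_neg, sub_eq_add_neg]

end RightQModule

/-- Let `J` be a right `ℍ`-linear map on a right `ℍ`-module with
`J² = −I` and let `ι ∈ 𝕊`. Every `x` decomposes uniquely as `x = x₊ + x₋` with
`x₊ ∈ H₊^{Jι}`, `x₋ ∈ H₋^{Jι}`, namely `x₊ = (x − (Jx)·ι)·(1/2)`, `x₋ = (x + (Jx)·ι)·(1/2)`;
in particular `H₊^{Jι} ∩ H₋^{Jι} = {0}`. Moreover for every `j ∈ 𝕊` with `ιj = −jι`,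
the map `y ↦ y·j` is a bijection from `H₊^{Jι}` onto `H₋^{Jι}`. -/
theorem statement10 {H : Type*} [AddCommGroup H] (M : RightQModule H)
    (J : H → H) (hJlin : M.IsRightLinear J) (hJJ : ∀ u : H, J (J u) = -u)
    (ι : Quaternion ℝ) (hι : ι ^ 2 = -1) :
    let Hp : Set H := {u | J u = M.smul u ι}
    let Hm : Set H := {u | J u = -M.smul u ι}
    let xp : H → H := fun x => M.smul (x - M.smul (J x) ι) (((1 : ℝ) / 2 : ℝ) : Quaternion ℝ)
    let xm : H → H := fun x => M.smul (x + M.smul (J x) ι) (((1 : ℝ) / 2 : ℝ) : Quaternion ℝ)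
    (∀ x : H, xp x ∈ Hp ∧ xm x ∈ Hm ∧ x = xp x + xm x ∧
      ∀ a b : H, a ∈ Hp → b ∈ Hm → x = a + b → a = xp x ∧ b = xm x) ∧
    Hp ∩ Hm = {(0 : H)} ∧
    (∀ j : Quaternion ℝ, j ^ 2 = -1 → ι * j = -(j * ι) →
      Set.BijOn (fun y : H => M.smul y j) Hp Hm) := by
  intro Hp Hm xp xm
  have hιι := M.smul_smul_self_of_sq_eq_neg_one hι
  have uniq : ∀ x a b : H, a ∈ Hp → b ∈ Hm → x = a + b → a = xp x ∧ b = xm x := by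
    intro x a b (ha : J a = M.smul a ι) (hb : J b = -M.smul b ι) hx
    have hJx : M.smul (J x) ι = b - a := by
      rw [hx, hJlin.map_add, ha, hb, M.add_smul, M.neg_smul, hιι, hιι]
      abel
    constructor
    · change a = M.smul (x - M.smul (J x) ι) _
      rw [hJx, hx, show a + b - (b - a) = a + a by abel, M.add_self_smul_half]
    · change b = M.smul (x + M.smul (J x) ι) _
      rw [hJx, hx, show a + b + (b - a) = b + b by abel, M.add_self_smul_half]
  refine ⟨fun x => ⟨?_, ?_, ?_, uniq x⟩, ?_, ?_⟩
  · change J (M.smul _ _) = M.smul (M.smul _ _) ι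
    rw [hJlin.map_smul, M.smul_smul_coe_comm, hJlin.map_sub, hJlin.map_smul, hJJ,
      M.sub_smul x, hιι, M.neg_smul, sub_neg_eq_add, sub_neg_eq_add, add_comm]
  · change J (M.smul _ _) = -M.smul (M.smul _ _) ι
    rw [hJlin.map_smul, M.smul_smul_coe_comm, hJlin.map_add, hJlin.map_smul, hJJ,
      M.add_smul x, hιι, M.neg_smul x, ← M.neg_smul (_ + _), neg_add, neg_neg, add_comm]
  · change x = M.smul _ _ + M.smul _ _
    rw [← M.add_smul, sub_add_add_cancel, M.add_self_smul_half]
  · ext u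
    constructor
    · rintro ⟨hp : J u = M.smul u ι, hm : J u = -M.smul u ι⟩
      have h0 : M.smul (J u) ι = -u := by rw [hp, hιι]
      have h1 : M.smul (J u) ι = u := by rw [hm, M.neg_smul, hιι, neg_neg]
      have h2 : u + u = 0 := by rw [← eq_neg_iff_add_eq_zero, ← h0, h1]
      rw [Set.mem_singleton_iff, ← M.add_self_smul_half u, h2, M.zero_smul]
    · rintro rfl
      have hJ0 : J 0 = 0 := by simpa using hJlin.map_add 0 0
      constructor
      · change J 0 = M.smul 0 ι
        rw [hJ0, M.zero_smul]
      · change J 0 = -M.smul 0 ι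
        rw [hJ0, M.zero_smul, neg_zero]
  · intro j hj hanti
    have hjj := M.smul_smul_self_of_sq_eq_neg_one hj
    have hcomm : ∀ u : H, M.smul (M.smul u ι) j = -M.smul (M.smul u j) ι := fun u => by
      rw [← M.smul_mul, hanti, M.smul_neg, M.smul_mul]
    refine ⟨?_, ?_, ?_⟩
    · intro y (hy : J y = M.smul y ι)
      change J (M.smul y j) = -M.smul (M.smul y j) ι
      rw [hJlin.map_smul, hy, hcomm]
    · intro y _ z _ (hyz : M.smul y j = M.smul z j)
      rw [← neg_inj, ← hjj y, hyz, hjj]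
    · intro z (hz : J z = -M.smul z ι)
      refine ⟨-M.smul z j, ?_, ?_⟩
      · change J (-M.smul z j) = M.smul (-M.smul z j) ι
        rw [hJlin.map_neg, hJlin.map_smul, hz, M.neg_smul, hcomm, M.neg_smul, neg_neg]
      · change M.smul (-M.smul z j) j = z
        rw [M.neg_smul, hjj, neg_neg]
end

section
/- For all quaternions q, p: sup_{j ∈ 𝕊} |q + jp| = (|q|² + |p|² + 2|Im(p q̄)|)^{1/2}. Moreover the supremum is attained: if Im(p q̄) = ιβ with ι ∈ 𝕊 and β ≥ 0, then |q − ιp| = (|q|² + |p|² + 2|Im(p q̄)|)^{1/2}. (This identifies the C*-norm ‖q + ip‖ on the complexified quaternions ℍ_ℂ with the supremum of |q + jp| over j ∈ 𝕊.) -/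
open Quaternion in
theorem Quaternion.re_eq_zero_of_sq_eq_neg_one {j : ℍ[ℝ]} (hj : j ^ 2 = -1) : j.re = 0 := by
  have h0 := congrArg QuaternionAlgebra.re hj
  have h1 := congrArg QuaternionAlgebra.imI hj
  have h2 := congrArg QuaternionAlgebra.imJ hj
  have h3 := congrArg QuaternionAlgebra.imK hj
  simp [pow_two] at h0 h1 h2 h3
  by_contra hr
  have h1' : j.imI = 0 := mul_left_cancel₀ hr (by linarith)
  have h2' : j.imJ = 0 := mul_left_cancel₀ hr (by linarith)
  have h3' : j.imK = 0 := mul_left_cancel₀ hr (by linarith)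
  rw [h1', h2', h3'] at h0
  nlinarith [sq_nonneg j.re]

theorem Quaternion.norm_eq_one_of_sq_eq_neg_one {j : Quaternion ℝ} (hj : j ^ 2 = -1) :
    ‖j‖ = 1 := by
  have h := congrArg norm hj
  rw [norm_pow, norm_neg, norm_one] at h
  exact (pow_eq_one_iff_of_nonneg (norm_nonneg j) two_ne_zero).1 h

theorem Quaternion.re_le_norm (a : Quaternion ℝ) : a.re ≤ ‖a‖ := by
  have h := real_inner_le_norm a 1
  rwa [Quaternion.inner_def, star_one, mul_one, norm_one, mul_one] at h

theorem Quaternion.norm_add_mul_sq_of_sq_eq_neg_one (q p : Quaternion ℝ) {j : Quaternion ℝ}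
    (hj : j ^ 2 = -1) :
    ‖q + j * p‖ ^ 2 = ‖q‖ ^ 2 + ‖p‖ ^ 2 + 2 * (j * (p * star q).im).re := by
  have hre := Quaternion.re_eq_zero_of_sq_eq_neg_one hj
  have hdrop : (j * (p * star q).im).re = (j * p * star q).re := by
    rw [mul_assoc]
    simp only [Quaternion.re_mul, Quaternion.re_im, Quaternion.imI_im, Quaternion.imJ_im,
      Quaternion.imK_im, hre]
    ring
  rw [norm_add_sq_real, norm_mul, Quaternion.norm_eq_one_of_sq_eq_neg_one hj, one_mul,
    real_inner_comm, Quaternion.inner_def, hdrop]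
  ring

theorem Quaternion.exists_sq_eq_neg_one_im_eq_norm_smul (v : Quaternion ℝ) :
    ∃ ι : Quaternion ℝ, ι ^ 2 = -1 ∧ v.im = ‖v.im‖ • ι := by
  by_cases h : v.im = 0
  · refine ⟨Quaternion.coeComplex Complex.I, ?_, by rw [h, norm_zero, zero_smul]⟩
    rw [pow_two, ← Quaternion.coeComplex_mul, Complex.I_mul_I]
    ext <;> simp
  · have hn : ‖v.im‖ ≠ 0 := norm_ne_zero_iff.2 h
    refine ⟨‖v.im‖⁻¹ • v.im, ?_, by rw [smul_inv_smul₀ hn]⟩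
    have hsq : v.im ^ 2 = -((‖v.im‖ ^ 2 : ℝ) : Quaternion ℝ) := by
      rw [Quaternion.im_sq, Quaternion.normSq_eq_norm_mul_self, pow_two]
    rw [smul_pow, hsq, smul_neg, ← Quaternion.coe_smul, smul_eq_mul, inv_pow,
      inv_mul_cancel₀ (pow_ne_zero 2 hn), Quaternion.coe_one]

theorem Quaternion.norm_sub_mul_of_im_eq_smul (q p : Quaternion ℝ) {ι : Quaternion ℝ} {β : ℝ}
    (hι : ι ^ 2 = -1) (hβ : 0 ≤ β) (h : (p * star q).im = β • ι) :
    ‖q - ι * p‖ = Real.sqrt (‖q‖ ^ 2 + ‖p‖ ^ 2 + 2 * ‖(p * star q).im‖) := by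
  have hval : (-ι * (p * star q).im).re = ‖(p * star q).im‖ := by
    rw [h, norm_smul, Quaternion.norm_eq_one_of_sq_eq_neg_one hι, Real.norm_of_nonneg hβ,
      mul_smul_comm, neg_mul, ← pow_two, hι]
    simp
  have hsq := Quaternion.norm_add_mul_sq_of_sq_eq_neg_one q p (j := -ι) (by rw [neg_sq, hι])
  rw [hval, neg_mul, ← sub_eq_add_neg] at hsq
  rw [← hsq, Real.sqrt_sq (norm_nonneg _)]

/-- For all quaternions `q, p`:
`sup_{j ∈ 𝕊} |q + j p| = (|q|² + |p|² + 2|Im(p q̄)|)^{1/2}`, and the supremum is attained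
(`IsGreatest`). Moreover, if `Im(p q̄) = β • ι` with `ι ∈ 𝕊` and `β ≥ 0`, then the value is
attained at `−ι`: `|q − ι p| = (|q|² + |p|² + 2|Im(p q̄)|)^{1/2}`. This identifies the
`C*`-norm `‖q + ip‖` on `ℍ_ℂ` with `sup_{j ∈ 𝕊} |q + j p|`. -/
theorem statement17 (q p : Quaternion ℝ) :
    IsGreatest {r : ℝ | ∃ j : Quaternion ℝ, j ^ 2 = -1 ∧ r = ‖q + j * p‖}
      (Real.sqrt (‖q‖ ^ 2 + ‖p‖ ^ 2 + 2 * ‖(p * star q).im‖)) ∧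
    (∀ (ι : Quaternion ℝ) (β : ℝ), ι ^ 2 = -1 → 0 ≤ β → (p * star q).im = β • ι →
      ‖q - ι * p‖ = Real.sqrt (‖q‖ ^ 2 + ‖p‖ ^ 2 + 2 * ‖(p * star q).im‖)) := by
  refine ⟨⟨?_, ?_⟩, fun ι β hι hβ h => Quaternion.norm_sub_mul_of_im_eq_smul q p hι hβ h⟩
  · obtain ⟨ι, hι, h⟩ := Quaternion.exists_sq_eq_neg_one_im_eq_norm_smul (p * star q)
    refine ⟨-ι, by rw [neg_sq, hι], ?_⟩
    rw [neg_mul, ← sub_eq_add_neg,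
      Quaternion.norm_sub_mul_of_im_eq_smul q p hι (norm_nonneg _) h]
  · rintro r ⟨j, hj, rfl⟩
    apply Real.le_sqrt_of_sq_le
    rw [Quaternion.norm_add_mul_sq_of_sq_eq_neg_one q p hj]
    have hle := Quaternion.re_le_norm (j * (p * star q).im)
    rw [norm_mul, Quaternion.norm_eq_one_of_sq_eq_neg_one hj, one_mul] at hle
    linarith
end
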